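/- For d ≥ 2, κ_i ≥ 0 (i = 1,…,d+1), n ∈ ℕ_0 and 1 ≤ ℓ ≤ d: every polynomial f in d variables of degree at most n satisfies ‖ (√x_ℓ/√(1−x_ℓ)) (⟨x,∇⟩ − ∂_ℓ) f ‖_{κ,2}² + Σ_{i=1, i≠ℓ}^d ‖ (√(x_i(1−|x|))/√(1−x_ℓ)) ∂_i f ‖_{κ,2}² + Σ_{1≤i<j≤d, i≠ℓ, j≠ℓ} ‖ (√(x_i x_j)/√(1−x_ℓ)) ∂_{i,j} f ‖_{κ,2}² ≤ n(n+|κ|+d) ‖f‖_{κ,2}², and this inequality is sharp: there exists a nonzero polynomial f of degree exactly n for which equality holds. -/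

import Mathlib

open MeasureTheory Finset

noncomputable section

/-- The simplex `△^d = {x : x_i ≥ 0, x_1 + ⋯ + x_d ≤ 1}`. -/
def Splx (d : ℕ) : Set (Fin d → ℝ) := {x | (∀ i, 0 ≤ x i) ∧ ∑ i, x i ≤ 1}

/-- The `i`-th partial derivative. -/
def pd {d : ℕ} (i : Fin d) (f : (Fin d → ℝ) → ℝ) : (Fin d → ℝ) → ℝ :=
  fun x => fderiv ℝ f x (Pi.single i 1)

/-- `∂_{i,j} = ∂_i - ∂_j`. -/
def pdd {d : ℕ} (i j : Fin d) (f : (Fin d → ℝ) → ℝ) : (Fin d → ℝ) → ℝ :=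
  fun x => pd i f x - pd j f x

/-- `⟨x,∇⟩ = ∑ x_i ∂_i`. -/
def xgrad {d : ℕ} (f : (Fin d → ℝ) → ℝ) : (Fin d → ℝ) → ℝ :=
  fun x => ∑ i, x i * pd i f x

/-- The Jacobi weight `W_κ(x) = x_1^{κ_1} ⋯ x_d^{κ_d} (1-|x|)^{κ_{d+1}}`. -/
def Wk {d : ℕ} (κ : Fin (d+1) → ℝ) (x : Fin d → ℝ) : ℝ :=
  (∏ i : Fin d, x i ^ κ i.castSucc) * (1 - ∑ i, x i) ^ κ (Fin.last d)

/-- The spectral operator `D_κ`. -/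
def Dk {d : ℕ} (κ : Fin (d+1) → ℝ) (f : (Fin d → ℝ) → ℝ) (x : Fin d → ℝ) : ℝ :=
  (∑ i, x i * (1 - x i) * pd i (pd i f) x)
    - 2 * ∑ i, ∑ j ∈ Finset.univ.filter (fun j => i < j), x i * x j * pd i (pd j f) x
    + ∑ i, (κ i.castSucc + 1 - ((∑ k, κ k) + (d : ℝ) + 1) * x i) * pd i f x

/-- The normalizing constant `b_κ`. -/
def bk {d : ℕ} (κ : Fin (d+1) → ℝ) : ℝ :=
  Real.Gamma ((∑ i, κ i) + (d : ℝ) + 1) / ∏ i, Real.Gamma (κ i + 1)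

/-- The inner product `⟨f,g⟩_κ = b_κ ∫_{△^d} f g W_κ`. -/
def ipk {d : ℕ} (κ : Fin (d+1) → ℝ) (f g : (Fin d → ℝ) → ℝ) : ℝ :=
  bk κ * ∫ x in Splx d, f x * g x * Wk κ x

/-- The norm `‖f‖_{κ,2}`. -/
def nrm2 {d : ℕ} (κ : Fin (d+1) → ℝ) (f : (Fin d → ℝ) → ℝ) : ℝ :=
  Real.sqrt (ipk κ f f)

/-- Membership in `V_n^d(W_κ)`: a polynomial of degree (at most) `n` orthogonal to all
polynomials of lower degree. -/
def InVn (d n : ℕ) (κ : Fin (d+1) → ℝ) (f : MvPolynomial (Fin d) ℝ) : Prop :=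
  f.totalDegree ≤ n ∧ ∀ g : MvPolynomial (Fin d) ℝ, g.totalDegree < n →
    ipk κ (fun x => MvPolynomial.eval x f) (fun x => MvPolynomial.eval x g) = 0

/-- `x_k` for `1 ≤ k ≤ d+1`, with the convention `x_{d+1} = 1 - |x|`. -/
def xe {d : ℕ} (x : Fin d → ℝ) (k : Fin (d+1)) : ℝ :=
  if h : (k : ℕ) < d then x ⟨(k : ℕ), h⟩ else 1 - ∑ i, x i

/-- The left-hand side of the inequality \eqref{eq:B-ineq2}. -/
def dform {d : ℕ} (κ : Fin (d+1) → ℝ) (l : Fin d) (F : (Fin d → ℝ) → ℝ) : ℝ :=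
  nrm2 κ (fun x => Real.sqrt (x l) / Real.sqrt (1 - x l) * (xgrad F x - pd l F x)) ^ 2 +
  (∑ i ∈ Finset.univ.filter (fun i => i ≠ l),
    nrm2 κ (fun x =>
      Real.sqrt (x i * (1 - ∑ k, x k)) / Real.sqrt (1 - x l) * pd i F x) ^ 2) +
  ∑ i ∈ Finset.univ.filter (fun i => i ≠ l),
    ∑ j ∈ Finset.univ.filter (fun j => i < j ∧ j ≠ l),
      nrm2 κ (fun x => Real.sqrt (x i * x j) / Real.sqrt (1 - x l) * pdd i j F x) ^ 2

section

open MvPolynomial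

theorem hasFDerivAt_eval {d : ℕ} (f : MvPolynomial (Fin d) ℝ) (x : Fin d → ℝ) :
    HasFDerivAt (fun x => eval x f)
      (∑ i, eval x (pderiv i f) • (ContinuousLinearMap.proj i : (Fin d → ℝ) →L[ℝ] ℝ)) x := by
  induction f using MvPolynomial.induction_on with
  | C a => simpa using hasFDerivAt_const a x
  | add p q hp hq =>
    simp only [map_add, add_smul, Finset.sum_add_distrib]
    exact hp.add hq
  | mul_X p j hp =>
    have := hp.mul (hasFDerivAt_apply (𝕜 := ℝ) j x)
    simp only [map_mul, eval_X]
    refine this.congr_fderiv ?_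
    ext v
    simp [pderiv_X, Pi.single_apply, add_mul, Finset.sum_add_distrib, Finset.mul_sum, apply_ite]
    ring_nf

theorem pd_eval {d : ℕ} (f : MvPolynomial (Fin d) ℝ) (i : Fin d) (x : Fin d → ℝ) :
    pd i (fun x => eval x f) x = eval x (pderiv i f) := by
  simp [pd, (hasFDerivAt_eval f x).fderiv, Pi.single_apply]

theorem continuous_Wk {d : ℕ} {κ : Fin (d + 1) → ℝ} (hκ : ∀ i, 0 ≤ κ i) :
    Continuous (Wk κ) := by
  unfold Wk
  refine Continuous.mul (continuous_finsetProd _ fun i _ => ?_) ?_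
  · exact (continuous_apply i).rpow_const fun _ => Or.inr (hκ _)
  · exact Continuous.rpow_const (by fun_prop) fun _ => Or.inr (hκ _)

theorem isCompact_Splx (d : ℕ) : IsCompact (Splx d) := by
  refine IsCompact.of_isClosed_subset (isCompact_Icc (a := (0 : Fin d → ℝ)) (b := 1)) ?_ ?_
  · simp only [Splx, Set.ofPred_and, Set.ofPred_forall]
    exact (isClosed_iInter fun i => isClosed_le continuous_const (continuous_apply i)).inter
      (isClosed_le (by fun_prop) continuous_const)
  · exact fun x hx => ⟨hx.1, fun i =>
      (Finset.single_le_sum (fun j _ => hx.1 j) (Finset.mem_univ i)).trans hx.2⟩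

theorem measurableSet_Splx (d : ℕ) : MeasurableSet (Splx d) :=
  (isCompact_Splx d).isClosed.measurableSet

theorem integrableOn_Splx {d : ℕ} {g : (Fin d → ℝ) → ℝ} (hg : Continuous g) :
    IntegrableOn g (Splx d) :=
  hg.continuousOn.integrableOn_compact (isCompact_Splx d)

theorem Wk_nonneg {d : ℕ} (κ : Fin (d + 1) → ℝ) {x : Fin d → ℝ} (hx : x ∈ Splx d) :
    0 ≤ Wk κ x :=
  mul_nonneg (Finset.prod_nonneg fun i _ => Real.rpow_nonneg (hx.1 i) _)
    (Real.rpow_nonneg (by linarith [hx.2]) _)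

theorem integral_deriv_rpow_mul_rpow {a b c : ℝ} (ha : 0 ≤ a) (hb : 0 ≤ b) :
    ∫ t in Set.Icc 0 c, ((a + 1) * ((c - t) * (t ^ a * (c - t) ^ b)) -
      (b + 1) * (t * (t ^ a * (c - t) ^ b))) = 0 := by
  rcases lt_or_ge c 0 with hc | hc
  · simp [Set.Icc_eq_empty_of_lt hc]
  have h1 : Continuous fun t : ℝ => t ^ a := Real.continuous_rpow_const ha
  have h2 : Continuous fun t : ℝ => (c - t) ^ b :=
    (Real.continuous_rpow_const hb).comp (continuous_sub_left c)
  have h3 : Continuous fun t : ℝ => t ^ (a + 1) := Real.continuous_rpow_const (by linarith)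
  have h4 : Continuous fun t : ℝ => (c - t) ^ (b + 1) :=
    (Real.continuous_rpow_const (by linarith : 0 ≤ b + 1)).comp (continuous_sub_left c)
  rw [integral_Icc_eq_integral_Ioc, ← intervalIntegral.integral_of_le hc,
    intervalIntegral.integral_eq_sub_of_hasDerivAt_of_le hc
      (f := fun t => t ^ (a + 1) * (c - t) ^ (b + 1)) (h3.mul h4).continuousOn]
  · simp [Real.zero_rpow (by linarith : a + 1 ≠ 0), Real.zero_rpow (by linarith : b + 1 ≠ 0)]
  · intro t ht
    have ht0 : t ≠ 0 := ht.1.ne'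
    have ht1 : c - t ≠ 0 := (sub_pos.2 ht.2).ne'
    have := (Real.hasDerivAt_rpow_const (p := a + 1) (Or.inl ht0)).mul
      (((hasDerivAt_id t).const_sub c).rpow_const (p := b + 1) (Or.inl ht1))
    refine this.congr_deriv ?_
    simp only [id, add_sub_cancel_right, Real.rpow_add_one ht0, Real.rpow_add_one ht1]
    ring
  · exact Continuous.intervalIntegrable (by fun_prop) _ _

theorem integral_Splx_exchange {d : ℕ} {κ : Fin (d + 1) → ℝ} (hκ : ∀ i, 0 ≤ κ i) (i : Fin d) :
    (κ i.castSucc + 1) * ∫ x in Splx d, (1 - ∑ j, x j) * Wk κ x =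
      (κ (Fin.last d) + 1) * ∫ x in Splx d, x i * Wk κ x := by
  have hW := continuous_Wk hκ
  rw [← sub_eq_zero, ← integral_const_mul, ← integral_const_mul, ← integral_sub
    (integrableOn_Splx (by fun_prop)) (integrableOn_Splx (by fun_prop))]
  have hint : IntegrableOn (fun x => (κ i.castSucc + 1) * ((1 - ∑ j, x j) * Wk κ x) -
      (κ (Fin.last d) + 1) * (x i * Wk κ x)) (Splx d) := integrableOn_Splx (by fun_prop)
  rw [← integral_indicator (measurableSet_Splx d)]
  rw [← integrable_indicator_iff (measurableSet_Splx d)] at hint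
  obtain _ | m := d
  · exact i.elim0
  set e : ℝ × (Fin m → ℝ) ≃ᵐ (Fin (m + 1) → ℝ) :=
    (MeasurableEquiv.piFinSuccAbove (fun _ => ℝ) i).symm with he
  have hem : MeasurePreserving e :=
    (volume_preserving_piFinSuccAbove (fun _ : Fin (m + 1) => ℝ) i).symm _
  have hint' := (hem.integrable_comp_emb e.measurableEmbedding).2 hint
  rw [← hem.integral_comp e.measurableEmbedding]
  refine (integral_prod_symm _ hint').trans (integral_eq_zero_of_ae (.of_forall fun y => ?_))
  simp only [he, MeasurableEquiv.piFinSuccAbove_symm_apply, Fin.insertNthEquiv,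
    Equiv.coe_fn_mk, Function.comp_apply, Pi.zero_apply]
  by_cases hy : ∀ j, 0 ≤ y j
  · rw [← mul_zero (∏ j, y j ^ κ (i.succAbove j).castSucc), ← integral_deriv_rpow_mul_rpow
      (hκ i.castSucc) (hκ (Fin.last (m + 1))) (c := 1 - ∑ j, y j), ← integral_const_mul,
      ← integral_indicator measurableSet_Icc]
    congr 1 with t
    have hmem : i.insertNth t y ∈ Splx (m + 1) ↔ t ∈ Set.Icc 0 (1 - ∑ j, y j) := by
      simp only [Splx, Set.mem_ofPred_eq, Fin.forall_iff_succAbove i, Fin.insertNth_apply_same,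
        Fin.insertNth_apply_succAbove, Fin.sum_univ_succAbove _ i, Set.mem_Icc, hy,
        implies_true, and_true, le_sub_iff_add_le]
    simp only [Set.indicator, hmem]
    split_ifs
    · simp only [Wk, Fin.insertNth_apply_same, Fin.prod_univ_succAbove _ i,
        Fin.insertNth_apply_succAbove, Fin.sum_univ_succAbove _ i, ← sub_sub, sub_right_comm]
      ring
    · rfl
  · push Not at hy
    obtain ⟨j, hj⟩ := hy
    refine integral_eq_zero_of_ae (.of_forall fun t => Set.indicator_of_notMem (fun h => ?_) _)
    have := h.1 (i.succAbove j)
    rw [Fin.insertNth_apply_succAbove] at this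
    linarith

/-- The Euler operator `∑ x_i ∂_i` as a derivation on polynomials. -/
def euler (d : ℕ) : Derivation ℝ (MvPolynomial (Fin d) ℝ) (MvPolynomial (Fin d) ℝ) :=
  ∑ i, (X i : MvPolynomial (Fin d) ℝ) • pderiv i

theorem euler_apply {d : ℕ} (f : MvPolynomial (Fin d) ℝ) :
    euler d f = ∑ i, X i * pderiv i f := by
  simp only [euler, ← Derivation.coeFnAddMonoidHom_apply, map_sum, Finset.sum_apply]
  rfl

theorem euler_X {d : ℕ} (i : Fin d) : euler d (X i) = X i := by
  simp [euler_apply, pderiv_X, Pi.single_apply]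

theorem euler_monomial {d : ℕ} (a : Fin d →₀ ℕ) (r : ℝ) :
    euler d (monomial a r) = (a.degree : ℝ) • monomial a r := by
  simp only [euler_apply, X_mul_pderiv_monomial, ← Finset.sum_smul, Finsupp.degree_eq_sum,
    Nat.cast_smul_eq_nsmul]

/-- The differential operator `D_κ` acting on polynomials, with its lowering part separated. -/
def jacobiLower {d : ℕ} (κ : Fin (d + 1) → ℝ) :
    MvPolynomial (Fin d) ℝ →ₗ[ℝ] MvPolynomial (Fin d) ℝ :=
  ∑ i, (LinearMap.mulLeft ℝ (X i) ∘ₗ (pderiv i).toLinearMap ∘ₗ (pderiv i).toLinearMap +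
    (κ i.castSucc + 1) • (pderiv i).toLinearMap)

/-- The spectral operator `D_κ` on polynomials. -/
def jacobiOp {d : ℕ} (κ : Fin (d + 1) → ℝ) :
    MvPolynomial (Fin d) ℝ →ₗ[ℝ] MvPolynomial (Fin d) ℝ :=
  jacobiLower κ - (euler d).toLinearMap ∘ₗ (euler d).toLinearMap -
    ((∑ k, κ k) + (d : ℝ)) • (euler d).toLinearMap

theorem jacobiLower_apply {d : ℕ} (κ : Fin (d + 1) → ℝ) (f : MvPolynomial (Fin d) ℝ) :
    jacobiLower κ f =
      ∑ i, (X i * pderiv i (pderiv i f) + (κ i.castSucc + 1) • pderiv i f) := by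
  simp [jacobiLower, LinearMap.sum_apply]

theorem jacobiOp_apply {d : ℕ} (κ : Fin (d + 1) → ℝ) (f : MvPolynomial (Fin d) ℝ) :
    jacobiOp κ f = jacobiLower κ f - euler d (euler d f) -
      ((∑ k, κ k) + (d : ℝ)) • euler d f := rfl

/-- The carré du champ `∑ x_i ∂_i f ∂_i g - ⟨x,∇⟩f ⟨x,∇⟩g` of the spectral operator. -/
def carre {d : ℕ} (f g : MvPolynomial (Fin d) ℝ) : MvPolynomial (Fin d) ℝ :=
  (∑ i, X i * pderiv i f * pderiv i g) - euler d f * euler d g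

/-- The eigenvalue `n (n + |κ| + d)` of `-D_κ`. -/
def jacobiEig {d : ℕ} (κ : Fin (d + 1) → ℝ) (n : ℕ) : ℝ :=
  (n : ℝ) * ((n : ℝ) + (∑ k, κ k) + (d : ℝ))

theorem jacobiEig_mono {d : ℕ} {κ : Fin (d + 1) → ℝ} (hκ : ∀ i, 0 ≤ κ i) :
    Monotone (jacobiEig κ) := by
  intro m n h
  have h0 : 0 ≤ ∑ k, κ k := Finset.sum_nonneg fun i _ => hκ i
  have h1 : (m : ℝ) ≤ n := by exact_mod_cast h
  unfold jacobiEig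
  gcongr

theorem jacobiOp_mul_add_carre {d : ℕ} (κ : Fin (d + 1) → ℝ) (f g : MvPolynomial (Fin d) ℝ) :
    g * jacobiOp κ f + carre f g =
      ∑ i, ((κ i.castSucc + 1) • (g * pderiv i f) + X i * pderiv i (g * pderiv i f) -
        X i * (((∑ k, κ k) + (d : ℝ) + 1) • (g * pderiv i f) + euler d (g * pderiv i f))) := by
  have h1 : euler d (euler d f) = (∑ i, X i * euler d (pderiv i f)) + euler d f := by
    conv_lhs => rw [euler_apply f, map_sum]
    simp only [Derivation.leibniz, euler_X, smul_eq_mul, Finset.sum_add_distrib]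
    simp only [mul_comm (pderiv _ f), ← euler_apply]
  have h2 : ∑ i, X i * (((∑ k, κ k) + (d : ℝ) + 1) • (g * pderiv i f) +
      euler d (g * pderiv i f)) = ((∑ k, κ k) + (d : ℝ) + 1) • (g * euler d f) +
      g * (∑ i, X i * euler d (pderiv i f)) + euler d f * euler d g := by
    rw [euler_apply f]
    simp only [Derivation.leibniz, smul_eq_mul, Finset.mul_sum, Finset.sum_mul, Finset.smul_sum,
      ← Finset.sum_add_distrib, smul_eq_C_mul]
    refine Finset.sum_congr rfl fun i _ => ?_
    ring
  have h3 : ∑ i, ((κ i.castSucc + 1) • (g * pderiv i f) + X i * pderiv i (g * pderiv i f)) =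
      g * jacobiLower κ f + ∑ i, X i * pderiv i f * pderiv i g := by
    rw [jacobiLower_apply]
    simp only [Derivation.leibniz, smul_eq_mul, Finset.mul_sum, ← Finset.sum_add_distrib,
      smul_eq_C_mul]
    refine Finset.sum_congr rfl fun i _ => ?_
    ring
  rw [Finset.sum_sub_distrib, h2, h3, jacobiOp_apply, h1, carre]
  simp only [smul_eq_C_mul, map_add, map_one]
  ring

/-- Polynomials of total degree less than `n`. -/
def degreeLT (d n : ℕ) : Submodule ℝ (MvPolynomial (Fin d) ℝ) :=
  restrictSupport ℝ {a | a.degree < n}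

theorem mem_degreeLT_succ {d n : ℕ} {f : MvPolynomial (Fin d) ℝ} :
    f ∈ degreeLT d (n + 1) ↔ f.totalDegree ≤ n := by
  rw [← mem_restrictTotalDegree, degreeLT, restrictTotalDegree]
  simp only [Nat.lt_succ_iff, Finsupp.degree_apply, Finsupp.sum]

theorem degreeLT_mono (d : ℕ) : Monotone (degreeLT d) :=
  fun _ _ h => restrictSupport_mono ℝ fun _ ha => lt_of_lt_of_le ha h

instance (d n : ℕ) : FiniteDimensional ℝ (degreeLT d n) :=
  have := (Finsupp.finite_of_degree_lt (σ := Fin d) n).to_subtype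
  Module.Finite.of_basis (basisRestrictSupport ℝ {a : Fin d →₀ ℕ | a.degree < n})

theorem degreeLT_induction {d n : ℕ} {T : MvPolynomial (Fin d) ℝ →ₗ[ℝ] MvPolynomial (Fin d) ℝ}
    {S : Submodule ℝ (MvPolynomial (Fin d) ℝ)}
    (h : ∀ a : Fin d →₀ ℕ, a.degree < n → T (monomial a 1) ∈ S) {f : MvPolynomial (Fin d) ℝ}
    (hf : f ∈ degreeLT d n) : T f ∈ S := by
  have : degreeLT d n ≤ S.comap T := by
    rw [degreeLT, restrictSupport_eq_span, Submodule.span_le]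
    rintro _ ⟨a, ha, rfl⟩
    exact h a ha
  exact this hf

theorem monomial_mem_degreeLT {d n : ℕ} {a : Fin d →₀ ℕ} (r : ℝ) (ha : a.degree < n) :
    monomial a r ∈ degreeLT d n :=
  (monomial_mem_restrictSupport ℝ).2 (Or.inl ha)

theorem jacobiLower_monomial_mem {d : ℕ} (κ : Fin (d + 1) → ℝ) (a : Fin d →₀ ℕ) :
    jacobiLower κ (monomial a 1) ∈ degreeLT d a.degree := by
  rw [jacobiLower_apply]
  refine Submodule.sum_mem _ fun i _ => ?_
  rw [pderiv_monomial, X_mul_pderiv_monomial, one_mul]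
  by_cases hi : a i = 0
  · simp [hi]
  · have hle : Finsupp.single i 1 ≤ a := by simpa [Nat.one_le_iff_ne_zero] using hi
    have hlt : (a - Finsupp.single i 1).degree < a.degree := by
      have := congrArg Finsupp.degree (tsub_add_cancel_of_le hle)
      simp only [map_add, Finsupp.degree_single] at this
      omega
    exact add_mem (Submodule.smul_of_tower_mem _ _ (monomial_mem_degreeLT _ hlt))
      (Submodule.smul_mem _ _ (monomial_mem_degreeLT _ hlt))

theorem jacobiOp_monomial {d : ℕ} (κ : Fin (d + 1) → ℝ) (a : Fin d →₀ ℕ) :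
    jacobiOp κ (monomial a 1) =
      jacobiLower κ (monomial a 1) - jacobiEig κ a.degree • monomial a 1 := by
  rw [jacobiOp_apply, euler_monomial, Derivation.map_smul, euler_monomial, jacobiEig]
  module

theorem jacobiOp_mem {d n : ℕ} (κ : Fin (d + 1) → ℝ) {f : MvPolynomial (Fin d) ℝ}
    (hf : f ∈ degreeLT d n) : jacobiOp κ f ∈ degreeLT d n := by
  refine degreeLT_induction (fun a ha => ?_) hf
  rw [jacobiOp_monomial]
  exact sub_mem (degreeLT_mono d ha.le (jacobiLower_monomial_mem κ a))
    (Submodule.smul_mem _ _ (monomial_mem_degreeLT _ ha))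

theorem jacobiOp_add_eig_mem {d n : ℕ} (κ : Fin (d + 1) → ℝ) {f : MvPolynomial (Fin d) ℝ}
    (hf : f ∈ degreeLT d (n + 1)) : jacobiOp κ f + jacobiEig κ n • f ∈ degreeLT d n := by
  refine degreeLT_induction (T := jacobiOp κ + jacobiEig κ n • LinearMap.id) (fun a ha => ?_) hf
  rw [LinearMap.add_apply, LinearMap.smul_apply, LinearMap.id_apply]
  rcases (Nat.lt_succ_iff.1 ha).lt_or_eq with h | h
  · have := monomial_mem_degreeLT (1 : ℝ) h
    exact add_mem (jacobiOp_mem κ this) (Submodule.smul_mem _ _ this)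
  · rw [jacobiOp_monomial, h, sub_add_cancel, ← h]
    exact jacobiLower_monomial_mem κ a

theorem integrableOn_eval_mul_Wk {d : ℕ} {κ : Fin (d + 1) → ℝ} (hκ : ∀ i, 0 ≤ κ i)
    (p : MvPolynomial (Fin d) ℝ) : IntegrableOn (fun x => eval x p * Wk κ x) (Splx d) :=
  integrableOn_Splx (p.continuous_eval.mul (continuous_Wk hκ))

/-- Integration of polynomials against the Jacobi weight on the simplex. -/
def jacobiIntegral {d : ℕ} {κ : Fin (d + 1) → ℝ} (hκ : ∀ i, 0 ≤ κ i) :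
    MvPolynomial (Fin d) ℝ →ₗ[ℝ] ℝ where
  toFun p := ∫ x in Splx d, eval x p * Wk κ x
  map_add' p q := by
    simp only [map_add, add_mul]
    exact integral_add (integrableOn_eval_mul_Wk hκ p) (integrableOn_eval_mul_Wk hκ q)
  map_smul' r p := by
    simp only [smul_eval, mul_assoc, integral_const_mul, RingHom.id_apply, smul_eq_mul]

theorem jacobiIntegral_apply {d : ℕ} {κ : Fin (d + 1) → ℝ} (hκ : ∀ i, 0 ≤ κ i)
    (p : MvPolynomial (Fin d) ℝ) :
    jacobiIntegral hκ p = ∫ x in Splx d, eval x p * Wk κ x := rfl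

theorem monomial_mul_Wk {d : ℕ} {κ : Fin (d + 1) → ℝ} (hκ : ∀ i, 0 ≤ κ i) (a : Fin d →₀ ℕ)
    {x : Fin d → ℝ} (hx : x ∈ Splx d) :
    eval x (monomial a 1) * Wk κ x =
      Wk (fun k => κ k + (Fin.snoc (fun i => (a i : ℝ)) 0 : Fin (d + 1) → ℝ) k) x := by
  simp only [Wk, Fin.snoc_castSucc, Fin.snoc_last, add_zero, eval_monomial, one_mul,
    Finsupp.prod_fintype _ _ fun i => pow_zero (x i), ← mul_assoc, ← Finset.prod_mul_distrib]
  congr 1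
  refine Finset.prod_congr rfl fun i _ => ?_
  rw [Real.rpow_add_of_nonneg (hx.1 i) (hκ _) (Nat.cast_nonneg _), Real.rpow_natCast, mul_comm]

theorem jacobiIntegral_monomial_exchange {d : ℕ} {κ : Fin (d + 1) → ℝ} (hκ : ∀ i, 0 ≤ κ i)
    (a : Fin d →₀ ℕ) (i : Fin d) :
    (κ i.castSucc + a i + 1) * jacobiIntegral hκ ((1 - ∑ j, X j) * monomial a 1) =
      (κ (Fin.last d) + 1) * jacobiIntegral hκ (X i * monomial a 1) := by
  have h : ∀ k, 0 ≤ κ k + (Fin.snoc (fun i => (a i : ℝ)) 0 : Fin (d + 1) → ℝ) k := by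
    intro k
    refine add_nonneg (hκ k) ?_
    induction k using Fin.lastCases <;> simp
  have key := integral_Splx_exchange h i
  simp only [Fin.snoc_castSucc, Fin.snoc_last, add_zero] at key
  simp only [jacobiIntegral_apply, map_mul, mul_assoc, map_sub, map_one, map_sum, eval_X]
  convert key using 2 <;>
    exact setIntegral_congr_fun (measurableSet_Splx d) fun x hx => by
      simp only [monomial_mul_Wk hκ a hx]

theorem jacobiIntegral_X_mul_monomial {d : ℕ} {κ : Fin (d + 1) → ℝ} (hκ : ∀ i, 0 ≤ κ i)
    (a : Fin d →₀ ℕ) (i : Fin d) :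
    ((∑ k, κ k) + (d : ℝ) + 1 + a.degree) * jacobiIntegral hκ (X i * monomial a 1) =
      (κ i.castSucc + a i + 1) * jacobiIntegral hκ (monomial a 1) := by
  set L := jacobiIntegral hκ with hL
  set μ := L ((1 - ∑ j, X j) * monomial a 1) with hμ
  have hl : κ (Fin.last d) + 1 ≠ 0 := by linarith [hκ (Fin.last d)]
  have h1 := fun j => jacobiIntegral_monomial_exchange hκ a j
  have h2 : L (monomial a 1) = μ + ∑ j, L (X j * monomial a 1) := by
    rw [hμ, ← map_sum, ← map_add]
    congr 1
    rw [← Finset.sum_mul]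
    ring
  have h3 : (κ (Fin.last d) + 1) * L (monomial a 1) =
      ((∑ k, κ k) + (d : ℝ) + 1 + a.degree) * μ := by
    rw [h2, mul_add, Finset.mul_sum, ← Finset.sum_congr rfl fun j _ => h1 j, ← Finset.sum_mul,
      Finset.sum_add_distrib, Finset.sum_add_distrib, Fin.sum_univ_castSucc,
      Finsupp.degree_eq_sum]
    simp
    ring
  apply mul_left_cancel₀ hl
  linear_combination -(κ i.castSucc + a i + 1) * h3 -
    ((∑ k, κ k) + (d : ℝ) + 1 + a.degree) * h1 i

theorem jacobiIntegral_divergence {d : ℕ} {κ : Fin (d + 1) → ℝ} (hκ : ∀ i, 0 ≤ κ i)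
    (h : MvPolynomial (Fin d) ℝ) (i : Fin d) :
    jacobiIntegral hκ ((κ i.castSucc + 1) • h + X i * pderiv i h -
      X i * (((∑ k, κ k) + (d : ℝ) + 1) • h + euler d h)) = 0 := by
  induction h using MvPolynomial.induction_on' with
  | monomial a r =>
    have hr : monomial a r = r • monomial a (1 : ℝ) := by simp [smul_monomial]
    have key := jacobiIntegral_X_mul_monomial hκ a i
    rw [X_mul_pderiv_monomial, euler_monomial, hr, ← Nat.cast_smul_eq_nsmul ℝ, ← add_smul,
      ← add_smul, mul_smul_comm, mul_smul_comm, map_sub, map_smul, map_smul, map_smul, map_smul]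
    simp only [smul_eq_mul]
    linear_combination -r * key
  | add p q hp hq =>
    refine Eq.trans ?_ ((congrArg₂ (· + ·) hp hq).trans (add_zero 0))
    rw [← map_add]
    congr 1
    simp only [map_add, smul_add, mul_add]
    abel

theorem jacobiIntegral_mul_jacobiOp {d : ℕ} {κ : Fin (d + 1) → ℝ} (hκ : ∀ i, 0 ≤ κ i)
    (f g : MvPolynomial (Fin d) ℝ) :
    jacobiIntegral hκ (g * jacobiOp κ f) = -jacobiIntegral hκ (carre f g) := by
  rw [eq_neg_iff_add_eq_zero, ← map_add, jacobiOp_mul_add_carre, map_sum]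
  exact Finset.sum_eq_zero fun i _ => jacobiIntegral_divergence hκ _ i

theorem carre_comm {d : ℕ} (f g : MvPolynomial (Fin d) ℝ) : carre f g = carre g f := by
  simp only [carre, mul_right_comm, mul_comm (euler d f)]

theorem carre_add_self {d : ℕ} (f g : MvPolynomial (Fin d) ℝ) :
    carre (f + g) (f + g) = carre f f + carre g g + 2 * carre f g := by
  have h : ∑ i, X i * pderiv i (f + g) * pderiv i (f + g) =
      (∑ i, X i * pderiv i f * pderiv i f) + (∑ i, X i * pderiv i g * pderiv i g) +
        2 * ∑ i, X i * pderiv i f * pderiv i g := by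
    simp only [Finset.mul_sum, ← Finset.sum_add_distrib, map_add]
    refine Finset.sum_congr rfl fun i _ => ?_
    ring
  rw [carre, h, map_add]
  simp only [carre]
  ring

theorem jacobiIntegral_mul_jacobiOp_comm {d : ℕ} {κ : Fin (d + 1) → ℝ} (hκ : ∀ i, 0 ≤ κ i)
    (f g : MvPolynomial (Fin d) ℝ) :
    jacobiIntegral hκ (g * jacobiOp κ f) = jacobiIntegral hκ (f * jacobiOp κ g) := by
  rw [jacobiIntegral_mul_jacobiOp, jacobiIntegral_mul_jacobiOp, carre_comm]

theorem jacobiIntegral_sq_nonneg {d : ℕ} {κ : Fin (d + 1) → ℝ} (hκ : ∀ i, 0 ≤ κ i)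
    (f : MvPolynomial (Fin d) ℝ) : 0 ≤ jacobiIntegral hκ (f * f) :=
  setIntegral_nonneg (measurableSet_Splx d) fun x hx => by
    rw [map_mul]
    exact mul_nonneg (mul_self_nonneg _) (Wk_nonneg κ hx)

theorem eq_zero_of_jacobiIntegral_sq_eq_zero {d : ℕ} {κ : Fin (d + 1) → ℝ} (hκ : ∀ i, 0 ≤ κ i)
    {f : MvPolynomial (Fin d) ℝ} (hf : jacobiIntegral hκ (f * f) = 0) : f = 0 := by
  set U : Set (Fin d → ℝ) := Set.univ.pi fun _ => Set.Ioo (0 : ℝ) (1 / (d + 1)) with hU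
  have hd : (0 : ℝ) < d + 1 := by positivity
  have hsum : ∀ x ∈ U, ∑ i, x i < 1 := by
    intro x hx
    calc ∑ i, x i ≤ ∑ _i : Fin d, 1 / ((d : ℝ) + 1) :=
          Finset.sum_le_sum fun i _ => (hx i trivial).2.le
      _ = d / (d + 1) := by simp [div_eq_mul_inv]
      _ < 1 := by rw [div_lt_one hd]; linarith
  have hUS : U ⊆ Splx d := fun x hx => ⟨fun i => (hx i trivial).1.le, (hsum x hx).le⟩
  have hUo : IsOpen U := isOpen_set_pi Set.finite_univ fun _ _ => isOpen_Ioo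
  have hc : Continuous fun x => eval x (f * f) * Wk κ x :=
    (f * f).continuous_eval.mul (continuous_Wk hκ)
  have hae : (fun x => eval x (f * f) * Wk κ x) =ᵐ[volume.restrict (Splx d)] 0 := by
    refine (setIntegral_eq_zero_iff_of_nonneg_ae ?_ (integrableOn_eval_mul_Wk hκ _)).1 hf
    filter_upwards [ae_restrict_mem (measurableSet_Splx d)] with x hx
    rw [map_mul]
    exact mul_nonneg (mul_self_nonneg _) (Wk_nonneg κ hx)
  have heq := Measure.eqOn_open_of_ae_eq (ae_restrict_of_ae_restrict_of_subset hUS hae) hUo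
    hc.continuousOn continuousOn_const
  refine MvPolynomial.funext_set (fun _ => Set.Ioo (0 : ℝ) (1 / (d + 1)))
    (fun _ => Set.Ioo_infinite (by positivity)) fun x hx => ?_
  have hW : Wk κ x ≠ 0 :=
    (mul_pos (Finset.prod_pos fun i _ => Real.rpow_pos_of_pos (hx i trivial).1 _)
      (Real.rpow_pos_of_pos (sub_pos.2 (hsum x hx)) _)).ne'
  simpa [hW] using heq hx

theorem exists_sub_orthogonal {d : ℕ} {κ : Fin (d + 1) → ℝ} (hκ : ∀ i, 0 ≤ κ i) (n : ℕ)
    (f : MvPolynomial (Fin d) ℝ) :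
    ∃ p ∈ degreeLT d n, ∀ q ∈ degreeLT d n, jacobiIntegral hκ ((f - p) * q) = 0 := by
  let T : degreeLT d n →ₗ[ℝ] Module.Dual ℝ (degreeLT d n) :=
    ((LinearMap.mul ℝ (MvPolynomial (Fin d) ℝ)).compr₂ (jacobiIntegral hκ)).domRestrict₁₂
      (degreeLT d n) (degreeLT d n)
  have hT : ∀ p q, T p q = jacobiIntegral hκ (p * q) := fun _ _ => rfl
  have hinj : Function.Injective T := by
    rw [injective_iff_map_eq_zero]
    intro p hp
    have : jacobiIntegral hκ (p * p) = 0 := by rw [← hT, hp]; rfl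
    exact Subtype.ext (eq_zero_of_jacobiIntegral_sq_eq_zero hκ this)
  obtain ⟨p, hp⟩ := (LinearMap.injective_iff_surjective_of_finrank_eq_finrank
    Subspace.dual_finrank_eq.symm).1 hinj
    ((jacobiIntegral hκ ∘ₗ LinearMap.mulLeft ℝ f) ∘ₗ (degreeLT d n).subtype)
  refine ⟨p, p.2, fun q hq => ?_⟩
  have := LinearMap.congr_fun hp ⟨q, hq⟩
  rw [hT] at this
  rw [sub_mul, map_sub, this]
  exact sub_self _

theorem jacobiOp_eq_of_orthogonal {d : ℕ} {κ : Fin (d + 1) → ℝ} (hκ : ∀ i, 0 ≤ κ i) {n : ℕ}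
    {v : MvPolynomial (Fin d) ℝ} (hv : v ∈ degreeLT d (n + 1))
    (horth : ∀ q ∈ degreeLT d n, jacobiIntegral hκ (v * q) = 0) :
    jacobiOp κ v = -jacobiEig κ n • v := by
  have hmem := jacobiOp_add_eig_mem κ hv
  have hz := eq_zero_of_jacobiIntegral_sq_eq_zero (f := jacobiOp κ v + jacobiEig κ n • v) hκ (by
    rw [mul_add, map_add, jacobiIntegral_mul_jacobiOp_comm, horth _ (jacobiOp_mem κ hmem),
      mul_smul_comm, map_smul, mul_comm, horth _ hmem, smul_zero, add_zero])
  rw [neg_smul]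
  exact eq_neg_of_add_eq_zero_left hz

theorem jacobiIntegral_carre_of_orthogonal {d : ℕ} {κ : Fin (d + 1) → ℝ} (hκ : ∀ i, 0 ≤ κ i)
    {n : ℕ} {v : MvPolynomial (Fin d) ℝ} (hv : v ∈ degreeLT d (n + 1))
    (horth : ∀ q ∈ degreeLT d n, jacobiIntegral hκ (v * q) = 0) (g : MvPolynomial (Fin d) ℝ) :
    jacobiIntegral hκ (carre v g) = jacobiEig κ n * jacobiIntegral hκ (v * g) := by
  have := jacobiIntegral_mul_jacobiOp hκ v g
  rw [jacobiOp_eq_of_orthogonal hκ hv horth, mul_smul_comm, map_smul, smul_eq_mul, mul_comm g v]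
    at this
  linarith

theorem jacobiIntegral_carre_le {d : ℕ} {κ : Fin (d + 1) → ℝ} (hκ : ∀ i, 0 ≤ κ i) (m : ℕ) :
    ∀ f ∈ degreeLT d m, ∀ n, m ≤ n + 1 →
      jacobiIntegral hκ (carre f f) ≤ jacobiEig κ n * jacobiIntegral hκ (f * f) := by
  induction m with
  | zero =>
    intro f hf n _
    have : f = 0 := by simpa [degreeLT, mem_restrictSupport_iff] using hf
    simp [this, carre]
  | succ m ih =>
    intro f hf n hmn
    obtain ⟨p, hp, hpo⟩ := exists_sub_orthogonal hκ m f
    set v := f - p with hvdef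
    have hv : v ∈ degreeLT d (m + 1) := sub_mem hf (degreeLT_mono d m.le_succ hp)
    have hf' : f = v + p := (sub_add_cancel f p).symm
    have h1 := jacobiIntegral_carre_of_orthogonal hκ hv hpo
    have h2 := ih p hp n (by omega)
    have h3 := mul_le_mul_of_nonneg_right (jacobiEig_mono hκ (by omega : m ≤ n))
      (jacobiIntegral_sq_nonneg hκ v)
    have h4 : (v + p) * (v + p) = v * v + p * p + (2 : ℝ) • (v * p) := by
      rw [two_smul]; ring
    have h5 : (2 : MvPolynomial (Fin d) ℝ) * carre v p = (2 : ℝ) • carre v p := by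
      rw [two_smul]; ring
    rw [hf', carre_add_self, h4, h5]
    simp only [map_add, map_smul, h1, hpo p hp, smul_eq_mul]
    linarith

theorem exists_jacobiIntegral_carre_eq {d : ℕ} {κ : Fin (d + 1) → ℝ} (hκ : ∀ i, 0 ≤ κ i)
    (n : ℕ) (i : Fin d) : ∃ f : MvPolynomial (Fin d) ℝ, f ≠ 0 ∧ f.totalDegree = n ∧
      jacobiIntegral hκ (carre f f) = jacobiEig κ n * jacobiIntegral hκ (f * f) := by
  obtain ⟨p, hp, hpo⟩ := exists_sub_orthogonal hκ n (X i ^ n)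
  have hX : (X i ^ n : MvPolynomial (Fin d) ℝ) ∈ degreeLT d (n + 1) := by
    simp [mem_degreeLT_succ]
  have hv := sub_mem hX (degreeLT_mono d n.le_succ hp)
  have hcoeff : coeff (Finsupp.single i n) (X i ^ n - p) = 1 := by
    have : Finsupp.single i n ∉ p.support := fun h => by simpa using hp h
    rw [coeff_sub, notMem_support_iff.1 this, X_pow_eq_monomial, coeff_monomial, if_pos rfl,
      sub_zero]
  refine ⟨X i ^ n - p, fun h => by simp [h] at hcoeff, ?_,
    jacobiIntegral_carre_of_orthogonal hκ hv hpo _⟩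
  refine le_antisymm (mem_degreeLT_succ.1 hv) ?_
  simpa using le_totalDegree (mem_support_iff.2 (hcoeff.trans_ne one_ne_zero))

theorem sum_lt_mul_sub_sq {d : ℕ} (T : Finset (Fin d)) (x a : Fin d → ℝ) :
    ∑ i ∈ T, ∑ j ∈ T with i < j, x i * x j * (a i - a j) ^ 2 =
      (∑ i ∈ T, x i) * (∑ i ∈ T, x i * a i ^ 2) - (∑ i ∈ T, x i * a i) ^ 2 := by
  induction T using Finset.induction_on_max with
  | empty => simp
  | insert m T hm ih =>
    have hmT : m ∉ T := fun h => lt_irrefl _ (hm m h)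
    have h1 : ∑ j ∈ insert m T with m < j, x m * x j * (a m - a j) ^ 2 = 0 := by
      rw [Finset.filter_false_of_mem, Finset.sum_empty]
      intro j hj
      rcases Finset.mem_insert.1 hj with rfl | hj
      · exact lt_irrefl _
      · exact (hm j hj).not_gt
    have h2 : ∀ i ∈ T, ∑ j ∈ insert m T with i < j, x i * x j * (a i - a j) ^ 2 =
        x i * x m * (a i - a m) ^ 2 + ∑ j ∈ T with i < j, x i * x j * (a i - a j) ^ 2 := by
      intro i hi
      rw [Finset.filter_insert, if_pos (hm i hi), Finset.sum_insert (by simp [hmT])]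
    have h3 : ∑ i ∈ T, x i * x m * (a i - a m) ^ 2 = x m * (∑ i ∈ T, x i * a i ^ 2) -
        2 * x m * a m * (∑ i ∈ T, x i * a i) + x m * a m ^ 2 * ∑ i ∈ T, x i := by
      simp only [Finset.mul_sum, ← Finset.sum_sub_distrib, ← Finset.sum_add_distrib]
      exact Finset.sum_congr rfl fun i _ => by ring
    simp only [Finset.sum_insert hmT]
    rw [h1, Finset.sum_congr rfl h2, Finset.sum_add_distrib, ih, h3]
    ring

theorem sqrt_div_sqrt_mul_mul_self {u s : ℝ} (q : ℝ) (hu : 0 ≤ u) (hs : 0 ≤ s) :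
    (√u / √s * q) * (√u / √s * q) = u / s * q ^ 2 := by
  rw [mul_mul_mul_comm, div_mul_div_comm, Real.mul_self_sqrt hu, Real.mul_self_sqrt hs, sq]

theorem apply_add_apply_le_one {d : ℕ} {x : Fin d → ℝ} (hx : x ∈ Splx d) {j l : Fin d}
    (hjl : j ≠ l) : x j + x l ≤ 1 := by
  rw [← Finset.sum_pair hjl]
  exact (Finset.sum_le_sum_of_subset_of_nonneg (Finset.subset_univ _)
    fun i _ _ => hx.1 i).trans hx.2

theorem apply_le_sum {d : ℕ} {x : Fin d → ℝ} (hx : x ∈ Splx d) (l : Fin d) :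
    x l ≤ ∑ k, x k :=
  Finset.single_le_sum (fun j _ => hx.1 j) (Finset.mem_univ l)

/-- The pointwise decomposition of the carré du champ with respect to the variable `x_l`. -/
theorem carre_decomposition {d : ℕ} (l : Fin d) {x : Fin d → ℝ} (hx : x ∈ Splx d)
    (a : Fin d → ℝ) :
    x l / (1 - x l) * ((∑ i, x i * a i) - a l) ^ 2 +
      (∑ i with i ≠ l, x i * (1 - ∑ k, x k) / (1 - x l) * a i ^ 2) +
      (∑ i with i ≠ l, ∑ j with i < j ∧ j ≠ l, x i * x j / (1 - x l) * (a i - a j) ^ 2) =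
      (∑ i, x i * a i * a i) - (∑ i, x i * a i) * (∑ i, x i * a i) := by
  have hsplit : ∀ g : Fin d → ℝ, ∑ i, g i = g l + ∑ i with i ≠ l, g i := by
    intro g
    rw [Finset.filter_ne', Finset.add_sum_erase _ _ (Finset.mem_univ l)]
  have h1 : ∑ i with i ≠ l, ∑ j with i < j ∧ j ≠ l, x i * x j / (1 - x l) * (a i - a j) ^ 2 =
      ((∑ i with i ≠ l, x i) * (∑ i with i ≠ l, x i * a i ^ 2) -
        (∑ i with i ≠ l, x i * a i) ^ 2) / (1 - x l) := by
    rw [← sum_lt_mul_sub_sq, Finset.sum_div]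
    refine Finset.sum_congr rfl fun i _ => ?_
    rw [Finset.sum_div, Finset.filter_filter]
    refine Finset.sum_congr (by simp only [and_comm]) fun j _ => by ring
  have h2 : ∑ i with i ≠ l, x i * (1 - ∑ k, x k) / (1 - x l) * a i ^ 2 =
      (1 - ∑ k, x k) / (1 - x l) * ∑ i with i ≠ l, x i * a i ^ 2 := by
    rw [Finset.mul_sum]
    exact Finset.sum_congr rfl fun i _ => by ring
  rw [h1, h2]
  rcases eq_or_ne (x l) 1 with hl | hl
  · have h0 : ∀ i, i ≠ l → x i = 0 := fun i hi =>
      le_antisymm (by linarith [apply_add_apply_le_one hx hi]) (hx.1 i)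
    have hz : ∀ g : Fin d → ℝ, ∑ i, x i * g i = g l := by
      intro g
      rw [Finset.sum_eq_single l (fun i _ hi => by rw [h0 i hi, zero_mul]) (by simp), hl, one_mul]
    simp only [mul_assoc, hz, hl]
    simp
  · have hs : 1 - x l ≠ 0 := sub_ne_zero.2 hl.symm
    simp only [mul_assoc, ← sq]
    simp only [hsplit x, hsplit fun i => x i * a i, hsplit fun i => x i * a i ^ 2]
    field_simp
    ring

theorem bk_pos {d : ℕ} {κ : Fin (d + 1) → ℝ} (hκ : ∀ i, 0 ≤ κ i) : 0 < bk κ := by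
  have h0 : 0 ≤ ∑ k, κ k := Finset.sum_nonneg fun i _ => hκ i
  exact div_pos (Real.Gamma_pos_of_pos (by positivity))
    (Finset.prod_pos fun i _ => Real.Gamma_pos_of_pos (by linarith [hκ i]))

theorem nrm2_sq {d : ℕ} {κ : Fin (d + 1) → ℝ} (hκ : ∀ i, 0 ≤ κ i) (g : (Fin d → ℝ) → ℝ) :
    nrm2 κ g ^ 2 = bk κ * ∫ x in Splx d, g x * g x * Wk κ x :=
  Real.sq_sqrt (mul_nonneg (bk_pos hκ).le (setIntegral_nonneg (measurableSet_Splx d)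
    fun _ hx => mul_nonneg (mul_self_nonneg _) (Wk_nonneg κ hx)))

theorem integrableOn_div_mul_Wk {d : ℕ} {κ : Fin (d + 1) → ℝ} (hκ : ∀ i, 0 ≤ κ i) (l : Fin d)
    {u q : (Fin d → ℝ) → ℝ} (hu : Continuous u) (hq : Continuous q)
    (hu0 : ∀ x ∈ Splx d, 0 ≤ u x) (hul : ∀ x ∈ Splx d, u x ≤ 1 - x l) :
    IntegrableOn (fun x => u x / (1 - x l) * q x ^ 2 * Wk κ x) (Splx d) := by
  have hW := continuous_Wk hκ
  have hg : IntegrableOn (fun x => q x ^ 2 * Wk κ x) (Splx d) := integrableOn_Splx (by fun_prop)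
  have hm : Measurable fun x : Fin d → ℝ => u x / (1 - x l) * q x ^ 2 * Wk κ x := by
    have := hu.measurable
    have := hq.measurable
    have := hW.measurable
    fun_prop
  refine hg.mono' hm.aestronglyMeasurable ?_
  filter_upwards [ae_restrict_mem (measurableSet_Splx d)] with x hx
  have hs : 0 ≤ 1 - x l := (hu0 x hx).trans (hul x hx)
  have hW0 := Wk_nonneg κ hx
  have hd := div_nonneg (hu0 x hx) hs
  rw [Real.norm_of_nonneg (by positivity), mul_assoc]
  exact mul_le_of_le_one_left (by positivity) (div_le_one_of_le₀ (hul x hx) hs)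

theorem eval_carre {d : ℕ} (f g : MvPolynomial (Fin d) ℝ) (x : Fin d → ℝ) :
    eval x (carre f g) = (∑ i, x i * eval x (pderiv i f) * eval x (pderiv i g)) -
      (∑ i, x i * eval x (pderiv i f)) * (∑ i, x i * eval x (pderiv i g)) := by
  simp [carre, euler_apply]

theorem dform_eq {d : ℕ} {κ : Fin (d + 1) → ℝ} (hκ : ∀ i, 0 ≤ κ i) (l : Fin d)
    (f : MvPolynomial (Fin d) ℝ) :
    dform κ l (fun x => eval x f) = bk κ * jacobiIntegral hκ (carre f f) := by
  set a : Fin d → (Fin d → ℝ) → ℝ := fun i x => eval x (pderiv i f) with ha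
  have hac : ∀ i, Continuous (a i) := fun i => (pderiv i f).continuous_eval
  have hcongr : ∀ {u q : (Fin d → ℝ) → ℝ}, (∀ x ∈ Splx d, 0 ≤ u x) →
      nrm2 κ (fun x => √(u x) / √(1 - x l) * q x) ^ 2 =
        bk κ * ∫ x in Splx d, u x / (1 - x l) * q x ^ 2 * Wk κ x := by
    intro u q hu
    rw [nrm2_sq hκ]
    congr 1
    refine setIntegral_congr_fun (measurableSet_Splx d) fun x hx => ?_
    have hs : 0 ≤ 1 - x l := by linarith [apply_le_sum hx l, hx.2]
    simp only [sqrt_div_sqrt_mul_mul_self (q x) (hu x hx) hs]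
  have hB0 : ∀ i, ∀ x ∈ Splx d, 0 ≤ x i * (1 - ∑ k, x k) :=
    fun i x hx => mul_nonneg (hx.1 i) (sub_nonneg.2 hx.2)
  have hC0 : ∀ i j, ∀ x ∈ Splx d, 0 ≤ x i * x j := fun i j x hx => mul_nonneg (hx.1 i) (hx.1 j)
  have hB : ∀ i, IntegrableOn (fun x => x i * (1 - ∑ k, x k) / (1 - x l) * a i x ^ 2 * Wk κ x)
      (Splx d) := fun i => integrableOn_div_mul_Wk hκ l (by fun_prop) (hac i) (hB0 i)
    fun x hx => by
      have h1 := apply_le_sum hx l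
      have h2 := (apply_le_sum hx i).trans hx.2
      exact (mul_le_of_le_one_left (sub_nonneg.2 hx.2) h2).trans (by linarith)
  have hC : ∀ i j, i ≠ l → j ≠ l → IntegrableOn
      (fun x => x i * x j / (1 - x l) * (a i x - a j x) ^ 2 * Wk κ x) (Splx d) :=
    fun i j _ hj => integrableOn_div_mul_Wk hκ l (by fun_prop) ((hac i).sub (hac j)) (hC0 i j)
    fun x hx => by
      have h1 := apply_add_apply_le_one hx hj
      have h2 := (apply_le_sum hx i).trans hx.2
      exact (mul_le_of_le_one_left (hx.1 j) h2).trans (by linarith)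
  have hBs := integrable_finsetSum (Finset.univ.filter fun i => i ≠ l) fun i _ => hB i
  have hCs := integrable_finsetSum (Finset.univ.filter fun i => i ≠ l) fun i hi =>
    integrable_finsetSum (Finset.univ.filter fun j => i < j ∧ j ≠ l) fun j hj =>
      hC i j (Finset.mem_filter.1 hi).2 (Finset.mem_filter.1 hj).2.2
  have hpt : ∀ x ∈ Splx d, x l / (1 - x l) * ((∑ i, x i * a i x) - a l x) ^ 2 * Wk κ x =
      eval x (carre f f) * Wk κ x -
      (∑ i with i ≠ l, x i * (1 - ∑ k, x k) / (1 - x l) * a i x ^ 2 * Wk κ x) -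
      (∑ i with i ≠ l, ∑ j with i < j ∧ j ≠ l,
        x i * x j / (1 - x l) * (a i x - a j x) ^ 2 * Wk κ x) := by
    intro x hx
    simp only [← Finset.sum_mul]
    rw [eval_carre, ← carre_decomposition l hx]
    ring
  have hA := setIntegral_congr_fun (μ := volume) (measurableSet_Splx d) hpt
  have hsub : Integrable (fun x => eval x (carre f f) * Wk κ x -
      ∑ i with i ≠ l, x i * (1 - ∑ k, x k) / (1 - x l) * a i x ^ 2 * Wk κ x)
      (volume.restrict (Splx d)) := (integrableOn_eval_mul_Wk hκ (carre f f)).sub hBs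
  rw [integral_sub hsub hCs, integral_sub (integrableOn_eval_mul_Wk hκ (carre f f)) hBs,
    integral_finsetSum _ fun i _ => hB i,
    integral_finsetSum _ fun i hi => integrable_finsetSum _ fun j hj =>
      hC i j (Finset.mem_filter.1 hi).2 (Finset.mem_filter.1 hj).2.2] at hA
  rw [Finset.sum_congr rfl fun i hi => integral_finsetSum _ fun j hj =>
      hC i j (Finset.mem_filter.1 hi).2 (Finset.mem_filter.1 hj).2.2] at hA
  simp only [dform, xgrad, pdd, pd_eval]
  rw [hcongr fun x hx => hx.1 l]
  simp only [hcongr (hB0 _), hcongr (hC0 _ _)]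
  simp only [ha] at hA
  rw [hA, jacobiIntegral_apply]
  simp only [← Finset.mul_sum]
  ring

theorem nrm2_eval_sq {d : ℕ} {κ : Fin (d + 1) → ℝ} (hκ : ∀ i, 0 ≤ κ i)
    (f : MvPolynomial (Fin d) ℝ) :
    nrm2 κ (fun x => eval x f) ^ 2 = bk κ * jacobiIntegral hκ (f * f) := by
  rw [nrm2_sq hκ]
  simp only [jacobiIntegral_apply, map_mul]

end

/-- the inequality \eqref{eq:B-ineq2}, and its sharpness. -/
theorem stmt13 (d : ℕ) (hd : 2 ≤ d) (κ : Fin (d+1) → ℝ) (hκ : ∀ i, 0 ≤ κ i)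
    (n : ℕ) (l : Fin d) :
    (∀ f : MvPolynomial (Fin d) ℝ, f.totalDegree ≤ n →
      dform κ l (fun x => MvPolynomial.eval x f) ≤
        (n : ℝ) * ((n : ℝ) + (∑ k, κ k) + (d : ℝ)) *
          nrm2 κ (fun x => MvPolynomial.eval x f) ^ 2) ∧
    (∃ f : MvPolynomial (Fin d) ℝ, f ≠ 0 ∧ f.totalDegree = n ∧
      dform κ l (fun x => MvPolynomial.eval x f) =
        (n : ℝ) * ((n : ℝ) + (∑ k, κ k) + (d : ℝ)) *
          nrm2 κ (fun x => MvPolynomial.eval x f) ^ 2) := by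
 
  have hE : (n : ℝ) * ((n : ℝ) + (∑ k, κ k) + (d : ℝ)) = jacobiEig κ n := rfl
  have hb := bk_pos hκ
  simp only [dform_eq hκ, nrm2_eval_sq hκ, hE, mul_left_comm _ (bk κ)]
  refine ⟨fun f hf => ?_, ?_⟩
  · exact mul_le_mul_of_nonneg_left
      (jacobiIntegral_carre_le hκ (n + 1) f (mem_degreeLT_succ.2 hf) n le_rfl) hb.le
  · obtain ⟨f, hf0, hfn, hf⟩ := exists_jacobiIntegral_carre_eq hκ n l
    exact ⟨f, hf0, hfn, by rw [hf]⟩
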